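/- Let w be a positive superharmonic function on 𝔻 and let f be holomorphic on 𝔻 with D_w(f) := (1/π)∫_𝔻 |f′(z)|² w(z) dA(z) < ∞. Then f belongs to the Hardy space H², i.e., sup_{0<r<1} (1/2π)∫₀^{2π} |f(r e^{iθ})|² dθ < ∞ (equivalently, ∑_{n≥0} |aₙ|² < ∞ where f(z) = ∑_{n≥0} aₙ zⁿ is the Taylor expansion at 0). -/

import Mathlib

open Complex MeasureTheory Metric Set

/-- `w : ℂ → ℝ` is superharmonic on the open unit disk: it is lower
semicontinuous there and satisfies the super-mean-value inequality on every
closed disk contained in `𝔻`. -/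
def SuperharmonicOnDisk (w : ℂ → ℝ) : Prop :=
  LowerSemicontinuousOn w (Metric.ball 0 1) ∧
    ∀ z₀ ∈ Metric.ball (0 : ℂ) 1, ∀ r > (0 : ℝ),
      Metric.closedBall z₀ r ⊆ Metric.ball 0 1 →
      (1 / (2 * Real.pi)) * ∫ θ in (0 : ℝ)..(2 * Real.pi),
          w (z₀ + r * Complex.exp (θ * Complex.I)) ≤ w z₀

theorem integrableOn_polar {G : ℂ → ℝ} (hG : Integrable G) :
    IntegrableOn (fun p : ℝ × ℝ => p.1 * G (p.1 * exp (p.2 * I)))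
      (Ioi 0 ×ˢ Ioo (-Real.pi) Real.pi) := by
  have h1 : Integrable (G ∘ measurableEquivRealProd.symm) :=
    (volume_preserving_equiv_real_prod.symm).integrable_comp_of_integrable hG
  have h2 : IntegrableOn (G ∘ measurableEquivRealProd.symm)
      (polarCoord.symm '' polarCoord.target) := h1.integrableOn
  rw [integrableOn_image_iff_integrableOn_abs_det_fderiv_smul volume
    polarCoord.open_target.measurableSet
    (fun p _ ↦ (hasFDerivAt_polarCoord_symm p).hasFDerivWithinAt) polarCoord.symm.injOn] at h2
  refine h2.congr_fun (fun p hp => ?_) polarCoord.open_target.measurableSet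
  have hp1 : 0 < p.1 := hp.1
  simp only [det_fderivPolarCoordSymm, abs_of_pos hp1, Function.comp, smul_eq_mul,
    measurableEquivRealProd_symm_polarCoord_symm_apply, Complex.polarCoord_symm_apply,
    exp_mul_I, ofReal_cos, ofReal_sin]

theorem intervalIntegral_circle_eq (G : ℂ → ℝ) (r : ℝ) :
    ∫ θ in Ioo (-Real.pi) Real.pi, G (r * exp (θ * I)) =
      ∫ θ in (0 : ℝ)..(2 * Real.pi), G (r * exp (θ * I)) := by
  have hp : Function.Periodic (fun θ : ℝ => G (r * exp (θ * I))) (2 * Real.pi) := fun θ => by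
    simp [add_mul, exp_add]
  have := hp.intervalIntegral_add_eq (-Real.pi) 0
  rw [show -Real.pi + 2 * Real.pi = Real.pi by ring, zero_add] at this
  rw [← this, intervalIntegral.integral_of_le (by linarith [Real.pi_pos]),
    integral_Ioc_eq_integral_Ioo]

theorem intervalIntegrable_circle_of_integrableOn (G : ℂ → ℝ) (r : ℝ)
    (h : IntegrableOn (fun θ : ℝ => G (r * exp (θ * I))) (Ioo (-Real.pi) Real.pi)) :
    IntervalIntegrable (fun θ : ℝ => G (r * exp (θ * I))) volume 0 (2 * Real.pi) := by
  have hp : Function.Periodic (fun θ : ℝ => G (r * exp (θ * I))) (2 * Real.pi) := fun θ => by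
    simp [add_mul, exp_add]
  refine hp.intervalIntegrable (t := -Real.pi) Real.two_pi_pos.ne' ?_ _ _
  rw [show -Real.pi + 2 * Real.pi = Real.pi by ring,
    intervalIntegrable_iff_integrableOn_Ioo_of_le (by linarith [Real.pi_pos])]
  exact h

theorem ae_intervalIntegrable_circle {G : ℂ → ℝ} (hG : Integrable G) :
    ∀ᵐ r : ℝ, 0 < r →
      IntervalIntegrable (fun θ : ℝ => G (r * exp (θ * I))) volume 0 (2 * Real.pi) := by
  have h := integrableOn_polar hG
  rw [IntegrableOn, Measure.volume_eq_prod, ← Measure.prod_restrict] at h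
  have h2 := h.prod_right_ae
  rw [ae_restrict_iff' measurableSet_Ioi] at h2
  filter_upwards [h2] with r hr hr0
  apply intervalIntegrable_circle_of_integrableOn
  have := (hr hr0).const_mul r⁻¹
  refine this.congr (Filter.Eventually.of_forall fun θ => ?_)
  simp only
  rw [inv_mul_cancel_left₀ (ne_of_gt hr0)]

theorem integrableOn_mul_circle_integral {G : ℂ → ℝ} (hG : Integrable G) :
    IntegrableOn (fun r : ℝ => r * ∫ θ in (0 : ℝ)..(2 * Real.pi), G (r * exp (θ * I)))
      (Ioi 0) := by
  have h := integrableOn_polar hG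
  rw [IntegrableOn, Measure.volume_eq_prod, ← Measure.prod_restrict] at h
  refine h.integral_prod_left.congr (Filter.Eventually.of_forall fun r => ?_)
  simp only
  rw [integral_const_mul, intervalIntegral_circle_eq]

theorem parseval_circle_range (c : ℕ → ℂ) (N : ℕ) :
    ∑ n ∈ Finset.range N, ‖c n‖ ^ 2 = (1 / (2 * Real.pi)) *
      ∫ θ in (0 : ℝ)..(2 * Real.pi), ‖∑ n ∈ Finset.range N, c n * exp (θ * I) ^ n‖ ^ 2 := by
  set p : Polynomial ℂ := ∑ n ∈ Finset.range N, Polynomial.monomial n (c n) with hp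
  have hcoeff : ∀ n, p.coeff n = if n < N then c n else 0 := fun n => by
    simp [hp, Polynomial.finsetSum_coeff, Polynomial.coeff_monomial]
  have h := p.sum_sq_norm_coeff_eq_circleAverage
  rw [Finset.sum_subset (s₂ := Finset.range N)] at h
  · rw [Real.circleAverage] at h
    simp only [circleMap, ofReal_one, one_mul, zero_add, smul_eq_mul] at h
    rw [one_div]
    convert h using 1
    · exact Finset.sum_congr rfl fun n hn => by rw [hcoeff, if_pos (Finset.mem_range.1 hn)]
    · simp [hp, Polynomial.eval_finsetSum, Polynomial.eval_monomial]
  · intro n hn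
    by_contra hN
    rw [Polynomial.mem_support_iff, hcoeff, if_neg (by simpa using hN)] at hn
    exact hn rfl
  · intro n _ hn
    rw [Polynomial.notMem_support_iff.1 hn]
    simp

theorem parseval_circle {c : ℕ → ℂ} (hc : Summable fun n => ‖c n‖) :
    HasSum (fun n => ‖c n‖ ^ 2)
      ((1 / (2 * Real.pi)) * ∫ θ in (0 : ℝ)..(2 * Real.pi), ‖∑' n, c n * exp (θ * I) ^ n‖ ^ 2) := by
  have hnn : ∀ n, 0 ≤ ‖c n‖ ^ 2 := fun n => by positivity
  rw [hasSum_iff_tendsto_nat_of_nonneg hnn]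
  simp_rw [parseval_circle_range]
  refine Filter.Tendsto.const_mul _ ?_
  refine intervalIntegral.tendsto_integral_filter_of_dominated_convergence
    (fun _ => (∑' n, ‖c n‖) ^ 2) (Filter.Eventually.of_forall fun N => ?_)
    (Filter.Eventually.of_forall fun N => Filter.Eventually.of_forall fun θ _ => ?_)
    (by simp) (Filter.Eventually.of_forall fun θ _ => ?_)
  · exact (by fun_prop : Continuous _).aestronglyMeasurable
  · rw [norm_pow, norm_norm]
    gcongr
    refine (norm_sum_le _ _).trans ?_
    simp only [norm_mul, norm_pow, norm_exp_ofReal_mul_I, one_pow, mul_one]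
    exact hc.sum_le_tsum _ (fun _ _ => norm_nonneg _)
  · have : Summable fun n => c n * exp (θ * I) ^ n := by
      refine Summable.of_norm ?_
      simpa [norm_exp_ofReal_mul_I] using hc
    exact (this.hasSum.tendsto_sum_nat.norm).pow 2

theorem barrier_lt_circle_mean {z₀ : ℂ} (hz : 3 / 4 ≤ ‖z₀‖ ^ 2) {r : ℝ} (hr : 0 < r) :
    2 - 3 * ‖z₀‖ ^ 2 + ‖z₀‖ ^ 4 < (1 / (2 * Real.pi)) * ∫ θ in (0 : ℝ)..(2 * Real.pi),
      (2 - 3 * ‖z₀ + r * exp (θ * I)‖ ^ 2 + ‖z₀ + r * exp (θ * I)‖ ^ 4) := by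
  have h1 : ‖z₀‖ ^ 2 + r ^ 2 = (1 / (2 * Real.pi)) * ∫ θ in (0 : ℝ)..(2 * Real.pi),
      ‖z₀ + r * exp (θ * I)‖ ^ 2 := by
    have := parseval_circle_range (fun n => if n = 0 then z₀ else r) 2
    simpa [-one_div, Finset.sum_range_succ] using this
  have h2 : ‖z₀‖ ^ 4 + 4 * ‖z₀‖ ^ 2 * r ^ 2 + r ^ 4 =
      (1 / (2 * Real.pi)) * ∫ θ in (0 : ℝ)..(2 * Real.pi), ‖z₀ + r * exp (θ * I)‖ ^ 4 := by
    have := parseval_circle_range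
      (fun n => if n = 0 then z₀ ^ 2 else if n = 1 then 2 * z₀ * r else r ^ 2) 3
    have h3 : ∀ θ : ℝ, ‖z₀ + r * exp (θ * I)‖ ^ 4 =
        ‖z₀ ^ 2 + 2 * z₀ * r * exp (θ * I) + r ^ 2 * exp (θ * I) ^ 2‖ ^ 2 := fun θ => by
      rw [show z₀ ^ 2 + 2 * z₀ * r * exp (θ * I) + r ^ 2 * exp (θ * I) ^ 2 =
        (z₀ + r * exp (θ * I)) ^ 2 by ring, norm_pow]
      ring
    simp_rw [h3]
    simp only [Finset.sum_range_succ, Finset.sum_range_zero, zero_add, if_true, one_ne_zero,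
      if_false, pow_zero, mul_one, pow_one, OfNat.ofNat_ne_zero, OfNat.ofNat_ne_one] at this
    rw [← this]
    simp only [norm_mul, norm_pow, norm_real, Real.norm_of_nonneg hr.le, RCLike.norm_ofNat]
    ring
  rw [intervalIntegral.integral_add, intervalIntegral.integral_sub,
    intervalIntegral.integral_const_mul, intervalIntegral.integral_const]
  rotate_left
  iterate 4 exact (by fun_prop : Continuous _).intervalIntegrable _ _
  have hpi := Real.pi_pos
  have e : (1 / (2 * Real.pi)) * ((2 * Real.pi - 0) • 2) = 2 := by
    rw [smul_eq_mul]; field_simp; ring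
  rw [mul_add, mul_sub, e, mul_left_comm, ← h1, ← h2]
  nlinarith [pow_pos hr 4, mul_nonneg (sub_nonneg.2 hz) (sq_nonneg r)]

theorem exists_mul_one_sub_sq_le {w : ℂ → ℝ} (hwpos : ∀ z ∈ ball (0 : ℂ) 1, 0 < w z)
    (hlsc : LowerSemicontinuousOn w (ball 0 1))
    (hw : ∀ z₀ ∈ ball (0 : ℂ) 1, ∀ δ > (0 : ℝ), ∃ r ∈ Ioo 0 δ,
      IntervalIntegrable (fun θ : ℝ => w (z₀ + r * exp (θ * I))) volume 0 (2 * Real.pi) ∧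
      (1 / (2 * Real.pi)) * ∫ θ in (0 : ℝ)..(2 * Real.pi), w (z₀ + r * exp (θ * I)) ≤ w z₀) :
    ∃ c > 0, ∀ z ∈ ball (0 : ℂ) 1, c * (1 - ‖z‖ ^ 2) ≤ w z := by
  have hK : closedBall (0 : ℂ) (9 / 10) ⊆ ball 0 1 := closedBall_subset_ball (by norm_num)
  obtain ⟨x, hx, hmin⟩ := (hlsc.mono hK).exists_isMinOn ⟨0, by simp; norm_num⟩ (isCompact_closedBall _ _)
  have hm := hwpos x (hK hx)
  set c := w x / 2 with hc
  have hc0 : 0 < c := by positivity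
  set h : ℂ → ℝ := fun z => 2 - 3 * ‖z‖ ^ 2 + ‖z‖ ^ 4 with hh
  have hcont : Continuous h := by fun_prop
  suffices H : ∀ z ∈ ball (0 : ℂ) 1, c * h z ≤ w z by
    refine ⟨c, hc0, fun z hz => le_trans ?_ (H z hz)⟩
    have : ‖z‖ < 1 := by simpa using hz
    gcongr
    simp only [hh]
    nlinarith [sq_nonneg (1 - ‖z‖ ^ 2)]
  intro z₁ hz₁
  by_contra! hlt
  have hz₁' : ‖z₁‖ < 1 := by simpa using hz₁
  have hlim : ∀ᶠ ρ : ℝ in nhdsWithin 1 (Iio 1), c * (2 - 3 * ρ ^ 2 + ρ ^ 4) < c * h z₁ - w z₁ := by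
    apply Filter.Eventually.filter_mono nhdsWithin_le_nhds
    have : Continuous fun ρ : ℝ => c * (2 - 3 * ρ ^ 2 + ρ ^ 4) := by fun_prop
    refine this.continuousAt.eventually_lt_const ?_
    norm_num
    exact hlt
  obtain ⟨ρ, ⟨hρ, hρ1⟩, hρz⟩ := ((hlim.and self_mem_nhdsWithin).and
    (Filter.Eventually.filter_mono nhdsWithin_le_nhds (eventually_gt_nhds hz₁'))).exists
  have hρ1 : ρ < 1 := hρ1
  have hKρ : closedBall (0 : ℂ) ρ ⊆ ball 0 1 := closedBall_subset_ball hρ1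
  have hlsc' : LowerSemicontinuousOn (fun z => w z + -(c * h z)) (closedBall 0 ρ) :=
    (hlsc.mono hKρ).add (by
      exact (by fun_prop : Continuous fun z => -(c * h z)).continuousOn.lowerSemicontinuousOn)
  have hz₁ρ : z₁ ∈ closedBall (0 : ℂ) ρ := by simpa using hρz.le
  obtain ⟨z₀, hz₀, hmin₀⟩ := hlsc'.exists_isMinOn ⟨z₁, hz₁ρ⟩ (isCompact_closedBall _ _)
  have hle := isMinOn_iff.1 hmin₀ z₁ hz₁ρ
  have hw₀ := hwpos z₀ (hKρ hz₀)
  have hz₀ρ : ‖z₀‖ ≤ ρ := by simpa using hz₀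
  have hne : ‖z₀‖ ≠ ρ := by
    intro he
    rw [← he] at hρ
    simp only [hh] at *
    linarith
  have hlt₀ : ‖z₀‖ < ρ := lt_of_le_of_ne hz₀ρ hne
  have hge : 3 / 4 ≤ ‖z₀‖ ^ 2 := by
    by_contra! hcon
    have h9 : ‖z₀‖ ≤ 9 / 10 := by nlinarith [norm_nonneg z₀]
    have := isMinOn_iff.1 hmin z₀ (by simpa using h9)
    have : c * h z₀ ≤ c * 2 := by
      gcongr
      simp only [hh]
      nlinarith [sq_nonneg ‖z₀‖]
    linarith
  obtain ⟨r, ⟨hr0, hrδ⟩, hint, hmean⟩ := hw z₀ (hKρ hz₀) (ρ - ‖z₀‖) (by linarith)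
  have hb := mul_lt_mul_of_pos_left (barrier_lt_circle_mean hge hr0) hc0
  have hmono : ∫ θ in (0 : ℝ)..(2 * Real.pi), (c * h (z₀ + r * exp (θ * I)) + (w z₀ - c * h z₀)) ≤
      ∫ θ in (0 : ℝ)..(2 * Real.pi), w (z₀ + r * exp (θ * I)) := by
    refine intervalIntegral.integral_mono_on Real.two_pi_pos.le
      ((by fun_prop : Continuous _).intervalIntegrable _ _) hint fun θ _ => ?_
    have := isMinOn_iff.1 hmin₀ (z₀ + r * exp (θ * I)) (by
      rw [mem_closedBall_zero_iff]
      refine (norm_add_le _ _).trans ?_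
      rw [norm_mul, norm_exp_ofReal_mul_I, norm_real, Real.norm_of_nonneg hr0.le]
      linarith)
    linarith
  rw [intervalIntegral.integral_add ((by fun_prop : Continuous _).intervalIntegrable _ _)
    ((by fun_prop : Continuous _).intervalIntegrable _ _), intervalIntegral.integral_const_mul,
    intervalIntegral.integral_const, sub_zero, smul_eq_mul] at hmono
  have hmono' := mul_le_mul_of_nonneg_left hmono (by positivity : 0 ≤ 1 / (2 * Real.pi))
  rw [mul_add, mul_left_comm, ← mul_assoc _ (2 * Real.pi),
    one_div_mul_cancel Real.two_pi_pos.ne', one_mul] at hmono'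
  simp only [hh] at *
  linarith

theorem bddAbove_circle_mean_of_integrableOn {f : ℂ → ℂ} (hf : DifferentiableOn ℂ f (ball 0 1))
    (hD : IntegrableOn (fun z => ‖deriv f z‖ ^ 2 * (1 - ‖z‖ ^ 2)) (ball 0 1)) :
    ∃ C : ℝ, ∀ r ∈ Ioo (0 : ℝ) 1, (1 / (2 * Real.pi)) * ∫ θ in (0 : ℝ)..(2 * Real.pi),
      ‖f (r * exp (θ * I))‖ ^ 2 ≤ C := by
  have hcircle : ∀ {g : ℂ → ℂ}, DifferentiableOn ℂ g (ball 0 1) → ∀ r ∈ Ioo (0 : ℝ) 1,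
      HasSum (fun n : ℕ => ‖(n.factorial : ℂ)⁻¹ * iteratedDeriv n g 0‖ ^ 2 * r ^ (2 * n))
        ((1 / (2 * Real.pi)) * ∫ θ in (0 : ℝ)..(2 * Real.pi), ‖g (r * exp (θ * I))‖ ^ 2) := by
    intro g hg r hr
    have hser : ∀ z ∈ ball (0 : ℂ) 1,
        HasSum (fun n : ℕ => ((n.factorial : ℂ)⁻¹ * iteratedDeriv n g 0) * z ^ n) (g z) := by
      intro z hz
      have := hasSum_taylorSeries_on_ball (r := 1) (by simpa using hg) (by simpa using hz)
      simp only [sub_zero, smul_eq_mul] at this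
      exact this.congr_fun fun n => by ring
    have hmem : (r : ℂ) ∈ ball (0 : ℂ) 1 := by
      simpa [abs_of_pos hr.1] using hr.2
    have hsum := (hser r hmem).summable.norm
    have hp := parseval_circle hsum
    have hpt : ∀ θ : ℝ, ∑' n : ℕ, ((n.factorial : ℂ)⁻¹ * iteratedDeriv n g 0) * (r : ℂ) ^ n *
        exp (θ * I) ^ n = g (r * exp (θ * I)) := fun θ => by
      rw [← (hser (r * exp (θ * I)) (by
        simpa [norm_exp_ofReal_mul_I, abs_of_pos hr.1] using hr.2)).tsum_eq]
      simp_rw [mul_pow, mul_assoc]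
    simp only [hpt] at hp
    convert hp using 2 with n
    rw [norm_mul _ ((r : ℂ) ^ n), mul_pow, norm_pow, norm_real, Real.norm_of_nonneg hr.1.le, pow_mul']
  have hf' : DifferentiableOn ℂ (deriv f) (ball 0 1) := hf.deriv isOpen_ball
  set a : ℕ → ℝ := fun n => ‖(n.factorial : ℂ)⁻¹ * iteratedDeriv n f 0‖ ^ 2 with ha
  have hcoef : ∀ n : ℕ, ‖(n.factorial : ℂ)⁻¹ * iteratedDeriv n (deriv f) 0‖ ^ 2 =
      (n + 1) ^ 2 * a (n + 1) := by
    intro n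
    have : (n.factorial : ℂ)⁻¹ * iteratedDeriv n (deriv f) 0 =
        ((n + 1 : ℝ) : ℂ) * (((n + 1).factorial : ℂ)⁻¹ * iteratedDeriv (n + 1) f 0) := by
      rw [iteratedDeriv_succ', Nat.factorial_succ]
      push_cast
      have : (n + 1 : ℂ) ≠ 0 := by exact_mod_cast n.succ_ne_zero
      have : (n.factorial : ℂ) ≠ 0 := by exact_mod_cast n.factorial_ne_zero
      field_simp
    rw [this, norm_mul, mul_pow, norm_real, Real.norm_of_nonneg (by positivity)]
  set G : ℂ → ℝ := (ball (0 : ℂ) 1).indicator fun z => ‖deriv f z‖ ^ 2 * (1 - ‖z‖ ^ 2) with hG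
  have hGint : Integrable G := (integrable_indicator_iff measurableSet_ball).2 hD
  have hR := (integrableOn_mul_circle_integral hGint).mono_set
    (Ioc_subset_Ioi_self : Ioc (0 : ℝ) 1 ⊆ Ioi 0)
  rw [← intervalIntegrable_iff_integrableOn_Ioc_of_le zero_le_one] at hR
  set K := ∫ r in (0 : ℝ)..1, r * ∫ θ in (0 : ℝ)..(2 * Real.pi), G (r * exp (θ * I)) with hKdef
  have hbound : ∀ N, ∑ n ∈ Finset.range N, a (n + 1) ≤ 2 * K / Real.pi := by
    intro N
    have h1 : ∫ r in (0 : ℝ)..1, 2 * Real.pi * ∑ n ∈ Finset.range N,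
        (n + 1) ^ 2 * a (n + 1) * (r ^ (2 * n + 1) - r ^ (2 * n + 3)) ≤ K := by
      refine intervalIntegral.integral_mono_on_of_le_Ioo zero_le_one
        ((by fun_prop : Continuous _).intervalIntegrable _ _) hR fun r hr => ?_
      have hGr : ∀ θ : ℝ, G (r * exp (θ * I)) =
          ‖deriv f (r * exp (θ * I))‖ ^ 2 * (1 - r ^ 2) := fun θ => by
        have hn : ‖(r : ℂ) * exp (θ * I)‖ = r := by
          rw [norm_mul, norm_exp_ofReal_mul_I, norm_real, Real.norm_of_nonneg hr.1.le, mul_one]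
        rw [hG, indicator_of_mem (by rw [mem_ball_zero_iff, hn]; exact hr.2), hn]
      simp only [hGr]
      rw [intervalIntegral.integral_mul_const]
      have hs := hcircle hf' r hr
      simp only [hcoef] at hs
      have hle := sum_le_hasSum (Finset.range N)
        (fun n _ => by have := hr.1; simp only [ha]; positivity) hs
      rw [one_div, le_inv_mul_iff₀ Real.two_pi_pos] at hle
      have hr2 : 0 ≤ r * (1 - r ^ 2) := mul_nonneg hr.1.le (by nlinarith [hr.1, hr.2])
      calc _ = (2 * Real.pi * ∑ n ∈ Finset.range N, (n + 1) ^ 2 * a (n + 1) * r ^ (2 * n)) *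
              (r * (1 - r ^ 2)) := by
            rw [mul_assoc (2 * Real.pi), Finset.sum_mul]
            congr 1
            exact Finset.sum_congr rfl fun n _ => by ring
        _ ≤ _ := mul_le_mul_of_nonneg_right hle hr2
        _ = _ := by ring
    have h2 : ∫ r in (0 : ℝ)..1, 2 * Real.pi * ∑ n ∈ Finset.range N,
        (n + 1) ^ 2 * a (n + 1) * (r ^ (2 * n + 1) - r ^ (2 * n + 3)) =
        2 * Real.pi * ∑ n ∈ Finset.range N, (n + 1) ^ 2 * a (n + 1) *
          (1 / (2 * n + 2) - 1 / (2 * n + 4)) := by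
      rw [intervalIntegral.integral_const_mul, intervalIntegral.integral_finsetSum
        fun n _ => (by fun_prop : Continuous _).intervalIntegrable _ _]
      congr 1
      refine Finset.sum_congr rfl fun n _ => ?_
      rw [intervalIntegral.integral_const_mul, intervalIntegral.integral_sub
        ((by fun_prop : Continuous _).intervalIntegrable _ _)
        ((by fun_prop : Continuous _).intervalIntegrable _ _), integral_pow, integral_pow]
      push_cast
      simp
      left
      ring
    have h3 : ∑ n ∈ Finset.range N, a (n + 1) * (1 / 4) ≤ ∑ n ∈ Finset.range N,
        (n + 1) ^ 2 * a (n + 1) * (1 / (2 * (n : ℝ) + 2) - 1 / (2 * n + 4)) := by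
      refine Finset.sum_le_sum fun n _ => ?_
      rw [mul_comm _ (a (n + 1)), mul_assoc]
      refine mul_le_mul_of_nonneg_left ?_ (by positivity)
      have : ((n : ℝ) + 1) ^ 2 * (1 / (2 * (n : ℝ) + 2) - 1 / (2 * n + 4)) =
          (n + 1) / (2 * (n + 2)) := by field_simp; ring
      rw [this, div_le_div_iff₀ (by norm_num) (by positivity)]
      linarith [(Nat.cast_nonneg n : (0 : ℝ) ≤ n)]
    rw [← Finset.sum_mul] at h3
    rw [le_div_iff₀ Real.pi_pos]
    nlinarith [Real.pi_pos]
  refine ⟨2 * K / Real.pi + a 0, fun r hr => ?_⟩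
  have hnn : ∀ n, 0 ≤ a n := fun n => by positivity
  refine le_of_tendsto' (hcircle hf r hr).tendsto_sum_nat fun N => ?_
  calc _ ≤ ∑ n ∈ Finset.range N, a n := Finset.sum_le_sum fun n _ =>
        mul_le_of_le_one_right (hnn n) (pow_le_one₀ hr.1.le hr.2.le)
    _ ≤ ∑ n ∈ Finset.range (N + 1), a n :=
        Finset.sum_le_sum_of_subset_of_nonneg (Finset.range_mono N.le_succ) fun n _ _ => hnn n
    _ ≤ _ := by
        rw [Finset.sum_range_succ']
        gcongr
        exact hbound N

theorem exists_intervalIntegrable_circle {w g : ℂ → ℝ} {z₀ : ℂ} (hz₀ : z₀ ∈ ball (0 : ℂ) 1)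
    (hint : IntegrableOn (fun z => g z * w z) (ball 0 1))
    (hg : ContinuousOn g (ball 0 1)) (hne : ∀ᶠ z in nhdsWithin z₀ {z₀}ᶜ, g z ≠ 0) {δ : ℝ}
    (hδ : 0 < δ) : ∃ r ∈ Ioo 0 δ, closedBall z₀ r ⊆ ball 0 1 ∧
      IntervalIntegrable (fun θ : ℝ => w (z₀ + r * exp (θ * I))) volume 0 (2 * Real.pi) := by
  have hG : Integrable (fun z => (ball (0 : ℂ) 1).indicator (fun z => g z * w z) (z₀ + z)) :=
    ((integrable_indicator_iff measurableSet_ball).2 hint).comp_add_left z₀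
  have hae := ae_intervalIntegrable_circle hG
  rw [eventually_nhdsWithin_iff, Metric.eventually_nhds_iff] at hne
  obtain ⟨ε, hε, hne⟩ := hne
  obtain ⟨η, hη, hball⟩ := Metric.isOpen_iff.1 isOpen_ball z₀ hz₀
  obtain ⟨r, hr, hrint⟩ : ∃ r ∈ Ioo 0 (min δ (min ε η)), 0 < r →
      IntervalIntegrable (fun θ : ℝ => (ball (0 : ℂ) 1).indicator (fun z => g z * w z)
        (z₀ + r * exp (θ * I))) volume 0 (2 * Real.pi) := by
    by_contra! hcon
    have h0 : volume (Ioo 0 (min δ (min ε η))) = 0 :=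
      measure_mono_null (fun r hr => by simpa using hcon r hr) (ae_iff.1 hae)
    rw [Real.volume_Ioo, ENNReal.ofReal_eq_zero] at h0
    have : 0 < min δ (min ε η) := by positivity
    linarith
  obtain ⟨hr0, hr1⟩ := hr
  simp only [lt_min_iff] at hr1
  have hsub : closedBall z₀ r ⊆ ball 0 1 := (closedBall_subset_ball hr1.2.2).trans hball
  refine ⟨r, ⟨hr0, hr1.1⟩, hsub, ?_⟩
  have hdist : ∀ θ : ℝ, dist (z₀ + r * exp (θ * I)) z₀ = r := fun θ => by
    rw [dist_eq_norm, add_sub_cancel_left, norm_mul, norm_exp_ofReal_mul_I, norm_real,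
      Real.norm_of_nonneg hr0.le, mul_one]
  have hmem : ∀ θ : ℝ, z₀ + r * exp (θ * I) ∈ ball (0 : ℂ) 1 := fun θ => hsub (hdist θ).le
  have hg0 : ∀ θ : ℝ, g (z₀ + r * exp (θ * I)) ≠ 0 := fun θ =>
    hne (by rw [hdist]; exact hr1.2.1) (fun h => hr0.ne' (by rw [← hdist θ, h, dist_self]))
  have hcont : Continuous fun θ : ℝ => (g (z₀ + r * exp (θ * I)))⁻¹ :=
    (hg.comp_continuous (by fun_prop) hmem).inv₀ hg0
  refine ((hrint hr0).continuousOn_mul hcont.continuousOn).congr fun θ _ => ?_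
  simp only [indicator_of_mem (hmem θ), inv_mul_cancel_left₀ (hg0 θ)]

/-- For a positive superharmonic weight `w` on `𝔻`, any holomorphic `f` on `𝔻`
with finite weighted Dirichlet integral `(1/π)∫_𝔻 |f′|² w dA < ∞` belongs to
the Hardy space `H²`: the integral means `(1/2π)∫₀^{2π} |f(re^{iθ})|² dθ` are
uniformly bounded for `0 < r < 1`. -/
theorem weighted_dirichlet_subset_hardy (w : ℂ → ℝ)
    (hwpos : ∀ z ∈ Metric.ball (0 : ℂ) 1, 0 < w z)
    (hwsh : SuperharmonicOnDisk w)
    (f : ℂ → ℂ) (hf : DifferentiableOn ℂ f (Metric.ball 0 1))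
    (hD : MeasureTheory.IntegrableOn (fun z => ‖deriv f z‖ ^ 2 * w z) (Metric.ball 0 1)) :
    ∃ C : ℝ, ∀ r ∈ Set.Ioo (0 : ℝ) 1,
      (1 / (2 * Real.pi)) * ∫ θ in (0 : ℝ)..(2 * Real.pi),
          ‖f (r * Complex.exp (θ * Complex.I))‖ ^ 2 ≤ C := by
  refine bddAbove_circle_mean_of_integrableOn hf ?_
  have hcont : ContinuousOn (deriv f) (ball 0 1) := (hf.deriv isOpen_ball).continuousOn
  have han : AnalyticOnNhd ℂ (deriv f) (ball 0 1) := (hf.deriv isOpen_ball).analyticOnNhd isOpen_ball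
  by_cases hz : ∃ z₀ ∈ ball (0 : ℂ) 1, ∀ᶠ z in nhds z₀, deriv f z = 0
  · obtain ⟨z₀, hz₀, hzero⟩ := hz
    have h0 := han.eqOn_zero_of_preconnected_of_eventuallyEq_zero
      (convex_ball (0 : ℂ) 1).isPreconnected hz₀ hzero
    refine integrableOn_zero.congr_fun (fun z hz => ?_) measurableSet_ball
    simp [h0 hz]
  · push Not at hz
    obtain ⟨c, hc, hle⟩ := exists_mul_one_sub_sq_le hwpos hwsh.1 fun z₀ hz₀ δ hδ => by
      have hne : ∀ᶠ z in nhdsWithin z₀ {z₀}ᶜ, ‖deriv f z‖ ^ 2 ≠ 0 := by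
        rcases (han z₀ hz₀).eventually_eq_zero_or_eventually_ne_zero with h | h
        · exact absurd h (Filter.not_eventually.2 (hz z₀ hz₀))
        · exact h.mono fun z hz => by simpa using hz
      obtain ⟨r, hr, hsub, hint⟩ :=
        exists_intervalIntegrable_circle hz₀ hD (hcont.norm.pow 2) hne hδ
      exact ⟨r, hr, hint, hwsh.2 z₀ hz₀ r hr.1 hsub⟩
    refine (hD.const_mul c⁻¹).mono' ?_ ?_
    · exact ((hcont.norm.pow 2).mul (by fun_prop)).aestronglyMeasurable measurableSet_ball
    · refine (ae_restrict_iff' measurableSet_ball).2 (Filter.Eventually.of_forall fun z hz => ?_)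
      have hz1 : ‖z‖ < 1 := by simpa using hz
      have h1 : 0 ≤ 1 - ‖z‖ ^ 2 := by nlinarith [norm_nonneg z]
      rw [Real.norm_of_nonneg (by positivity), le_inv_mul_iff₀ hc, mul_left_comm]
      exact mul_le_mul_of_nonneg_left (hle z hz) (by positivity)
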